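/- Let M be a ℤ-module and B a symmetric bilinear form on M with values in ℤ. Suppose there exists e ∈ M with B(e,e) = −1, and suppose c ∈ M is characteristic for B, i.e. B(c,x) ≡ B(x,x) (mod 2) for every x ∈ M. Then there exists c' ∈ M, also characteristic for B, such that B(c − c', c − c') < 0. In particular, it is not the case that every pair of characteristic elements of M has difference of square 0. -/

import Mathlib

/-- If there is `e` with `B e e = -1` and `c` is characteristic for the
symmetric ℤ-bilinear form `B`, then there is a characteristic `c'` with
`B(c - c', c - c') < 0`; in particular not every pair of characteristic elements has
difference of square zero. -/
theorem exists_characteristic_with_negative_difference_square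
    {M : Type*} [AddCommGroup M] [Module ℤ M]
    (B : M →ₗ[ℤ] M →ₗ[ℤ] ℤ) (hsymm : ∀ x y : M, B x y = B y x)
    (e : M) (he : B e e = -1)
    (c : M) (hc : ∀ x : M, B c x ≡ B x x [ZMOD 2]) :
    (∃ c' : M, (∀ x : M, B c' x ≡ B x x [ZMOD 2]) ∧ B (c - c') (c - c') < 0) ∧
      ¬ (∀ c₁ c₂ : M, (∀ x : M, B c₁ x ≡ B x x [ZMOD 2]) →
          (∀ x : M, B c₂ x ≡ B x x [ZMOD 2]) → B (c₁ - c₂) (c₁ - c₂) = 0) := by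
  have key : ∃ c' : M, (∀ x : M, B c' x ≡ B x x [ZMOD 2]) ∧ B (c - c') (c - c') < 0 := by
    refine ⟨c + (e + e), fun x => ?_, ?_⟩
    · have h := hc x
      simp only [map_add, LinearMap.add_apply, Int.ModEq] at h ⊢
      omega
    · have h : c - (c + (e + e)) = -(e + e) := by abel
      rw [h]
      simp [he]
  refine ⟨key, fun H => ?_⟩
  obtain ⟨c', hc', hlt⟩ := key
  exact hlt.ne (H c c' hc hc')
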